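/- For every c ∈ ℝ, the total variation distance d_TV(η_c, ν_SC) equals f_1(c), where f_1(c) = (2(1 − e^{2c})/π)·arcsin(e^{−c}/2) + ((e^{−2c} + 2)/(4π))·√(4e^{2c} − 1) if c ≥ −ln 2, and f_1(c) = 1 − e^{2c} if c < −ln 2. -/

import Mathlib

open MeasureTheory

/-- The total variation distance between two finite measures on `ℝ`:
`d_TV(μ,ν) = sup_{A Borel} |μ(A) - ν(A)|`. -/
noncomputable def dTV (μ ν : Measure ℝ) : ℝ :=
  ⨆ A : {A : Set ℝ // MeasurableSet A}, |(μ A.1).toReal - (ν A.1).toReal|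

/-- The standard semicircle distribution on `ℝ`, with Lebesgue density
`x ↦ (√(4-x²)/(2π))·1_{|x|<2}`. -/
noncomputable def nuSC : Measure ℝ :=
  volume.withDensity fun x =>
    ENNReal.ofReal (if |x| < 2 then Real.sqrt (4 - x ^ 2) / (2 * Real.pi) else 0)

/-- The measure `η_c = 1_{c<0}(1-e^{2c})·δ_{γ_c} + (e^c √(4-x²) 1_{|x|<2}/(2π(γ_c - x)))·dx`,
where `γ_c = e^c + e^{-c}`. -/
noncomputable def eta (c : ℝ) : Measure ℝ :=
  ENNReal.ofReal ((if c < 0 then 1 else 0) * (1 - Real.exp (2 * c))) •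
      Measure.dirac (Real.exp c + Real.exp (-c)) +
    volume.withDensity fun x =>
      ENNReal.ofReal (Real.exp c * Real.sqrt (4 - x ^ 2) * (if |x| < 2 then 1 else 0) /
        (2 * Real.pi * ((Real.exp c + Real.exp (-c)) - x)))

/-- If `S` maximizes `ν - μ` among measurable sets, it realizes the total variation distance. -/
theorem dTV_eq_of_maximizer (μ ν : Measure ℝ) [IsProbabilityMeasure μ] [IsProbabilityMeasure ν]
    {S : Set ℝ} (hS : MeasurableSet S)
    (hmax : ∀ A, MeasurableSet A → ν.real A - μ.real A ≤ ν.real S - μ.real S) :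
    dTV μ ν = ν.real S - μ.real S := by
  have hbound : ∀ A : {A : Set ℝ // MeasurableSet A},
      |(μ A.1).toReal - (ν A.1).toReal| ≤ ν.real S - μ.real S := by
    rintro ⟨A, hA⟩
    have h1 := hmax A hA
    have h2 := hmax Aᶜ hA.compl
    rw [probReal_compl_eq_one_sub hA, probReal_compl_eq_one_sub hA] at h2
    simp only [Measure.real] at h1 h2 ⊢
    rw [abs_le]
    constructor <;> linarith
  have : Nonempty {A : Set ℝ // MeasurableSet A} := ⟨⟨S, hS⟩⟩
  refine le_antisymm (ciSup_le hbound) ?_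
  refine le_trans ?_ (le_ciSup (f := fun A : {A : Set ℝ // MeasurableSet A} =>
    |(μ A.1).toReal - (ν A.1).toReal|) ⟨_, by rintro _ ⟨A, rfl⟩; exact hbound A⟩ ⟨S, hS⟩)
  rw [abs_sub_comm]
  exact le_abs_self _

/-- The total integral and the distribution function of a nonnegative function supported on
`[l, u]`, from an antiderivative. -/
theorem integral_of_hasDerivAt_of_support {k K : ℝ → ℝ} {l u : ℝ} (hlu : l ≤ u)
    (hcont : ContinuousOn K (Set.Icc l u)) (hderiv : ∀ x ∈ Set.Ioo l u, HasDerivAt K (k x) x)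
    (hpos : ∀ x, 0 ≤ k x) (hsupp : ∀ x, x ∉ Set.Ioo l u → k x = 0) :
    Integrable k ∧ (∀ t ∈ Set.Icc l u, ∫ x in Set.Iic t, k x = K t - K l) ∧
      ∫ x, k x = K u - K l := by
  have hint : IntervalIntegrable k volume l u := by
    refine intervalIntegral.intervalIntegrable_deriv_of_nonneg (g := K) ?_ ?_ fun x _ => hpos x
    · rwa [Set.uIcc_of_le hlu]
    · simpa [hlu] using hderiv
  have hIoc : ∀ t ∈ Set.Icc l u, ∫ x in Set.Ioc l t, k x = K t - K l := by
    intro t ht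
    rw [← intervalIntegral.integral_of_le ht.1]
    refine intervalIntegral.integral_eq_sub_of_hasDerivAt_of_le ht.1
      (hcont.mono (Set.Icc_subset_Icc_right ht.2))
      (fun x hx => hderiv x ⟨hx.1, hx.2.trans_le ht.2⟩) (hint.mono_set ?_)
    rw [Set.uIcc_of_le ht.1, Set.uIcc_of_le hlu]
    exact Set.Icc_subset_Icc_right ht.2
  refine ⟨?_, fun t ht => ?_, ?_⟩
  · rw [intervalIntegrable_iff_integrableOn_Ioc_of_le hlu] at hint
    refine (integrableOn_iff_integrable_of_support_subset fun x hx => ?_).1 hint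
    by_contra h
    exact hx (hsupp x fun h' => h ⟨h'.1, h'.2.le⟩)
  · rw [← hIoc t ht]
    refine setIntegral_eq_of_subset_of_forall_sdiff_eq_zero measurableSet_Iic
      (fun x hx => hx.2) fun x hx => hsupp x fun h => hx.2 ⟨h.1, hx.1⟩
  · rw [← hIoc u ⟨hlu, le_rfl⟩]
    refine (setIntegral_eq_integral_of_forall_compl_eq_zero fun x hx => ?_).symm
    exact hsupp x fun h => hx ⟨h.1, h.2.le⟩

theorem sqrt_four_sub_sq_eq_zero {x : ℝ} (hx : x ∉ Set.Ioo (-2 : ℝ) 2) :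
    Real.sqrt (4 - x ^ 2) = 0 := by
  refine Real.sqrt_eq_zero_of_nonpos ?_
  by_contra! h
  exact hx ⟨by nlinarith, by nlinarith⟩

theorem hasDerivAt_sqrt_four_sub_sq {x : ℝ} (hx : x ∈ Set.Ioo (-2 : ℝ) 2) :
    HasDerivAt (fun x => Real.sqrt (4 - x ^ 2)) (-x / Real.sqrt (4 - x ^ 2)) x := by
  have h0 : 0 < 4 - x ^ 2 := by nlinarith [hx.1, hx.2]
  have h1 : HasDerivAt (fun x : ℝ => 4 - x ^ 2) (-(2 * x)) x := by
    simpa using (hasDerivAt_pow 2 x).const_sub 4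
  refine (h1.sqrt h0.ne').congr_deriv ?_
  have := (Real.sqrt_pos.2 h0).ne'
  field_simp

theorem hasDerivAt_arcsin_half {x : ℝ} (hx : x ∈ Set.Ioo (-2 : ℝ) 2) :
    HasDerivAt (fun x => Real.arcsin (x / 2)) (1 / Real.sqrt (4 - x ^ 2)) x := by
  have h0 : 0 < 4 - x ^ 2 := by nlinarith [hx.1, hx.2]
  have h := (Real.hasDerivAt_arcsin (x := x / 2) (by linarith [hx.1]) (by linarith [hx.2])).comp x
    ((hasDerivAt_id x).div_const 2)
  refine h.congr_deriv ?_
  have h2 : Real.sqrt (1 - (x / 2) ^ 2) = Real.sqrt (4 - x ^ 2) / 2 := by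
    rw [Real.sqrt_eq_iff_mul_self_eq_of_pos (by have := Real.sqrt_pos.2 h0; positivity)]
    linear_combination (1 / 4) * Real.sq_sqrt h0.le
  rw [h2]
  have := (Real.sqrt_pos.2 h0).ne'
  field_simp

/-- The semicircle density. -/
noncomputable def semicircleDensity (x : ℝ) : ℝ := Real.sqrt (4 - x ^ 2) / (2 * Real.pi)

/-- An antiderivative of the semicircle density. -/
noncomputable def semicirclePrimitive (x : ℝ) : ℝ :=
  (x * Real.sqrt (4 - x ^ 2) / 2 + 2 * Real.arcsin (x / 2)) / (2 * Real.pi)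

theorem semicircleDensity_nonneg (x : ℝ) : 0 ≤ semicircleDensity x := by
  unfold semicircleDensity; positivity

theorem hasDerivAt_semicirclePrimitive {x : ℝ} (hx : x ∈ Set.Ioo (-2 : ℝ) 2) :
    HasDerivAt semicirclePrimitive (semicircleDensity x) x := by
  have h0 : 0 < 4 - x ^ 2 := by nlinarith [hx.1, hx.2]
  have h := (((hasDerivAt_id x).mul (hasDerivAt_sqrt_four_sub_sq hx)).div_const 2).add
    ((hasDerivAt_arcsin_half hx).const_mul 2) |>.div_const (2 * Real.pi)
  refine h.congr_deriv ?_
  have hs := Real.sqrt_pos.2 h0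
  have h2 := Real.sq_sqrt h0.le
  simp only [semicircleDensity, id]
  generalize Real.sqrt (4 - x ^ 2) = s at *
  field_simp
  linear_combination -h2

theorem semicircle_integrals :
    Integrable semicircleDensity ∧
      (∀ t ∈ Set.Icc (-2 : ℝ) 2, ∫ x in Set.Iic t, semicircleDensity x =
        semicirclePrimitive t - semicirclePrimitive (-2)) ∧
      ∫ x, semicircleDensity x = semicirclePrimitive 2 - semicirclePrimitive (-2) := by
  refine integral_of_hasDerivAt_of_support (by norm_num) ?_
    (fun x hx => hasDerivAt_semicirclePrimitive hx) semicircleDensity_nonneg fun x hx => ?_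
  · unfold semicirclePrimitive
    fun_prop
  · simp [semicircleDensity, sqrt_four_sub_sq_eq_zero hx]

/-- The absolutely continuous part of `η_c`, as a function of `a = e^c`. -/
noncomputable def etaDensity (a x : ℝ) : ℝ :=
  a * Real.sqrt (4 - x ^ 2) / (2 * Real.pi * (a + a⁻¹ - x))

/-- An antiderivative of `etaDensity a`. -/
noncomputable def etaPrimitive (a x : ℝ) : ℝ :=
  a / (2 * Real.pi) * (-Real.sqrt (4 - x ^ 2) + (a + a⁻¹) * Real.arcsin (x / 2) -
    |a - a⁻¹| * Real.arcsin (((a + a⁻¹) * x - 4) / (2 * (a + a⁻¹ - x))))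

theorem add_inv_sq_sub_four {a : ℝ} (ha : 0 < a) : (a + a⁻¹) ^ 2 - 4 = |a - a⁻¹| ^ 2 := by
  rw [sq_abs]
  field_simp
  ring

theorem two_le_add_inv {a : ℝ} (ha : 0 < a) : 2 ≤ a + a⁻¹ := by
  have h1 := add_inv_sq_sub_four ha
  have h2 : 0 < a⁻¹ := by positivity
  nlinarith [sq_nonneg |a - a⁻¹|]

theorem two_lt_add_inv {a : ℝ} (ha : 0 < a) (h : 0 < |a - a⁻¹|) : 2 < a + a⁻¹ := by
  have h1 := add_inv_sq_sub_four ha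
  have h2 : 0 < a⁻¹ := by positivity
  nlinarith [sq_pos_of_pos h]

theorem etaDensity_nonneg {a : ℝ} (ha : 0 < a) (x : ℝ) : 0 ≤ etaDensity a x := by
  unfold etaDensity
  by_cases hx : x ∈ Set.Ioo (-2 : ℝ) 2
  · have : 0 < a + a⁻¹ - x := by linarith [two_le_add_inv ha, hx.2]
    positivity
  · simp [sqrt_four_sub_sq_eq_zero hx]

theorem hasDerivAt_abs_mul_arcsin {a x : ℝ} (ha : 0 < a) (hx : x ∈ Set.Ioo (-2 : ℝ) 2) :
    HasDerivAt
      (fun x => |a - a⁻¹| * Real.arcsin (((a + a⁻¹) * x - 4) / (2 * (a + a⁻¹ - x))))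
      (|a - a⁻¹| ^ 2 / ((a + a⁻¹ - x) * Real.sqrt (4 - x ^ 2))) x := by
  have hsq := add_inv_sq_sub_four ha
  have hx' : 0 < a + a⁻¹ - x := by linarith [two_le_add_inv ha, hx.2]
  rcases (abs_nonneg (a - a⁻¹)).eq_or_lt with h | hd
  · simpa [← h] using hasDerivAt_const x (0 : ℝ)
  generalize |a - a⁻¹| = d at *
  generalize a + a⁻¹ = g at *
  have h0 : 0 < 4 - x ^ 2 := by nlinarith [hx.1, hx.2]
  have hs := Real.sqrt_pos.2 h0
  have hs2 := Real.sq_sqrt h0.le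
  have hone : 1 - ((g * x - 4) / (2 * (g - x))) ^ 2 =
      (d * Real.sqrt (4 - x ^ 2) / (2 * (g - x))) ^ 2 := by
    rw [div_pow, div_pow, mul_pow d, hs2, ← hsq]
    field_simp
    ring
  have hroot : Real.sqrt (1 - ((g * x - 4) / (2 * (g - x))) ^ 2) =
      d * Real.sqrt (4 - x ^ 2) / (2 * (g - x)) := by
    rw [hone, Real.sqrt_sq (by positivity)]
  have hlt : ((g * x - 4) / (2 * (g - x))) ^ 2 < 1 := by
    have : 0 < (d * Real.sqrt (4 - x ^ 2) / (2 * (g - x))) ^ 2 := by positivity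
    linarith
  have hu : HasDerivAt (fun x => (g * x - 4) / (2 * (g - x))) (d ^ 2 / (2 * (g - x) ^ 2)) x := by
    have h := (((hasDerivAt_id x).const_mul g).sub_const 4).div
      (((hasDerivAt_id x).const_sub g).const_mul 2) (by simpa using hx'.ne')
    refine h.congr_deriv ?_
    rw [← hsq]
    simp only [id]
    field_simp
    ring
  have hlt' := abs_lt.1 ((sq_lt_one_iff_abs_lt_one _).1 hlt)
  have h := ((Real.hasDerivAt_arcsin hlt'.1.ne' hlt'.2.ne).comp x hu).const_mul d
  refine h.congr_deriv ?_
  rw [hroot]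
  field_simp

theorem hasDerivAt_etaPrimitive {a x : ℝ} (ha : 0 < a) (hx : x ∈ Set.Ioo (-2 : ℝ) 2) :
    HasDerivAt (etaPrimitive a) (etaDensity a x) x := by
  have h0 : 0 < 4 - x ^ 2 := by nlinarith [hx.1, hx.2]
  have hx' : 0 < a + a⁻¹ - x := by linarith [two_le_add_inv ha, hx.2]
  have h := (((hasDerivAt_sqrt_four_sub_sq hx).neg.add
    ((hasDerivAt_arcsin_half hx).const_mul (a + a⁻¹))).sub
    (hasDerivAt_abs_mul_arcsin ha hx)).const_mul (a / (2 * Real.pi))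
  refine h.congr_deriv ?_
  have hs := Real.sqrt_pos.2 h0
  have h2 := Real.sq_sqrt h0.le
  rw [← add_inv_sq_sub_four ha]
  unfold etaDensity
  generalize a + a⁻¹ = g at *
  generalize Real.sqrt (4 - x ^ 2) = s at *
  field_simp
  linear_combination -h2

theorem continuousOn_etaPrimitive {a : ℝ} (ha : 0 < a) :
    ContinuousOn (etaPrimitive a) (Set.Icc (-2) 2) := by
  unfold etaPrimitive
  refine continuousOn_const.mul (ContinuousOn.sub (by fun_prop) ?_)
  rcases (abs_nonneg (a - a⁻¹)).eq_or_lt with h | hd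
  · simpa [← h] using continuousOn_const
  have hg := two_lt_add_inv ha hd
  refine continuousOn_const.mul (Real.continuous_arcsin.comp_continuousOn ?_)
  refine ContinuousOn.div (by fun_prop) (by fun_prop) fun x hx => ?_
  have : 0 < a + a⁻¹ - x := by linarith [hx.2]
  positivity

theorem etaDensity_integrals {a : ℝ} (ha : 0 < a) :
    Integrable (etaDensity a) ∧
      (∀ t ∈ Set.Icc (-2 : ℝ) 2, ∫ x in Set.Iic t, etaDensity a x =
        etaPrimitive a t - etaPrimitive a (-2)) ∧
      ∫ x, etaDensity a x = etaPrimitive a 2 - etaPrimitive a (-2) := by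
  refine integral_of_hasDerivAt_of_support (by norm_num) (continuousOn_etaPrimitive ha)
    (fun x hx => hasDerivAt_etaPrimitive ha hx) (etaDensity_nonneg ha) fun x hx => ?_
  simp [etaDensity, sqrt_four_sub_sq_eq_zero hx]

theorem semicirclePrimitive_two : semicirclePrimitive 2 = 1 / 2 := by
  have h : (4 : ℝ) - 2 ^ 2 = 0 := by norm_num
  simp only [semicirclePrimitive, h, Real.sqrt_zero]
  norm_num
  field_simp

theorem semicirclePrimitive_neg_two : semicirclePrimitive (-2) = -(1 / 2) := by
  have h : (4 : ℝ) - (-2) ^ 2 = 0 := by norm_num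
  simp only [semicirclePrimitive, h, Real.sqrt_zero]
  norm_num
  field_simp

theorem etaPrimitive_two {a : ℝ} (ha : 0 < a) :
    etaPrimitive a 2 = a * (a + a⁻¹ - |a - a⁻¹|) / 4 := by
  have h : (4 : ℝ) - 2 ^ 2 = 0 := by norm_num
  have harc : |a - a⁻¹| * Real.arcsin (((a + a⁻¹) * 2 - 4) / (2 * (a + a⁻¹ - 2))) =
      |a - a⁻¹| * (Real.pi / 2) := by
    rcases (abs_nonneg (a - a⁻¹)).eq_or_lt with h | hd
    · simp [← h]
    have hg : 0 < a + a⁻¹ - 2 := by linarith [two_lt_add_inv ha hd]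
    rw [show ((a + a⁻¹) * 2 - 4) / (2 * (a + a⁻¹ - 2)) = 1 by
      rw [div_eq_one_iff_eq (by positivity)]; ring, Real.arcsin_one]
  rw [etaPrimitive, harc, h, Real.sqrt_zero, div_self two_ne_zero, Real.arcsin_one]
  generalize |a - a⁻¹| = d
  generalize a⁻¹ = b
  field_simp
  ring

theorem etaPrimitive_neg_two {a : ℝ} (ha : 0 < a) :
    etaPrimitive a (-2) = -(a * (a + a⁻¹ - |a - a⁻¹|) / 4) := by
  have h : (4 : ℝ) - (-2) ^ 2 = 0 := by norm_num
  have hg : 0 < a + a⁻¹ - -2 := by linarith [two_le_add_inv ha]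
  rw [etaPrimitive, h, Real.sqrt_zero, show ((a + a⁻¹) * -2 - 4) / (2 * (a + a⁻¹ - -2)) = -1 by
    rw [div_eq_iff (by positivity)]; ring, neg_div, div_self two_ne_zero, Real.arcsin_neg,
    Real.arcsin_one]
  generalize |a - a⁻¹| = d
  generalize a⁻¹ = b
  field_simp
  ring

theorem integral_semicircleDensity : ∫ x, semicircleDensity x = 1 := by
  rw [semicircle_integrals.2.2, semicirclePrimitive_two, semicirclePrimitive_neg_two]
  norm_num

theorem integral_etaDensity {a : ℝ} (ha : 0 < a) :
    ∫ x, etaDensity a x = if a < 1 then a ^ 2 else 1 := by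
  rw [(etaDensity_integrals ha).2.2, etaPrimitive_two ha, etaPrimitive_neg_two ha]
  split_ifs with h
  · have : 1 < a⁻¹ := (one_lt_inv₀ ha).2 h
    rw [abs_of_neg (by linarith)]
    ring
  · have : a⁻¹ ≤ 1 := inv_le_one_of_one_le₀ (not_lt.1 h)
    rw [abs_of_nonneg (by linarith)]
    field_simp
    ring

/-- The value of `etaPrimitive a` at the point `a⁻¹` where the two densities cross. -/
theorem etaPrimitive_inv {a : ℝ} (ha : 2⁻¹ ≤ a) :
    etaPrimitive a a⁻¹ = a / (2 * Real.pi) * (-Real.sqrt (4 - a⁻¹ ^ 2) +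
      (4 * a - 2 * a⁻¹) * Real.arcsin (a⁻¹ / 2) +
        (a⁻¹ - a + |a - a⁻¹|) * (Real.pi / 2)) := by
  have ha0 : 0 < a := by linarith
  have hb0 : 0 < a⁻¹ := by positivity
  have hb2 : a⁻¹ ≤ 2 := inv_le_of_inv_le₀ (by norm_num) ha
  set φ := Real.arcsin (a⁻¹ / 2) with hφ
  have hsin : Real.sin φ = a⁻¹ / 2 := Real.sin_arcsin (by linarith) (by linarith)
  have hφ0 : 0 ≤ φ := Real.arcsin_nonneg.2 (by linarith)
  have hφ1 : φ ≤ Real.pi / 2 := Real.arcsin_le_pi_div_two _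
  have hu : ((a + a⁻¹) * a⁻¹ - 4) / (2 * (a + a⁻¹ - a⁻¹)) = -Real.sin (3 * φ) := by
    rw [Real.sin_three_mul, hsin]
    field_simp
    ring
  have hpi := Real.pi_pos
  rw [etaPrimitive, hu, Real.arcsin_neg]
  rcases le_total a 1 with h | h
  · have hb1 : 1 ≤ a⁻¹ := (one_le_inv₀ ha0).2 h
    have hφ2 : Real.pi / 6 ≤ φ := by
      rw [Real.le_arcsin_iff_sin_le ⟨by linarith, by linarith⟩ ⟨by linarith, by linarith⟩,
        Real.sin_pi_div_six]
      linarith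
    rw [← Real.sin_pi_sub, Real.arcsin_sin (by linarith) (by linarith),
      abs_of_nonpos (by linarith)]
    ring
  · have hb1 : a⁻¹ ≤ 1 := inv_le_one_of_one_le₀ h
    have hφ2 : φ ≤ Real.pi / 6 := by
      rw [Real.arcsin_le_iff_le_sin ⟨by linarith, by linarith⟩ ⟨by linarith, by linarith⟩,
        Real.sin_pi_div_six]
      linarith
    rw [Real.arcsin_sin (by linarith) (by linarith), abs_of_nonneg (by linarith)]
    ring

theorem primitive_difference_at_inv {a : ℝ} (ha : 2⁻¹ ≤ a) :
    (semicirclePrimitive a⁻¹ - semicirclePrimitive (-2)) -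
        (etaPrimitive a a⁻¹ - etaPrimitive a (-2)) =
      2 * (1 - a ^ 2) / Real.pi * Real.arcsin (a⁻¹ / 2) +
        ((a ^ 2)⁻¹ + 2) / (4 * Real.pi) * Real.sqrt (4 * a ^ 2 - 1) := by
  have ha0 : 0 < a := by linarith
  have hroot : Real.sqrt (4 - a⁻¹ ^ 2) = Real.sqrt (4 * a ^ 2 - 1) / a := by
    rw [show 4 - a⁻¹ ^ 2 = (4 * a ^ 2 - 1) / a ^ 2 by field_simp, Real.sqrt_div' _ (by positivity),
      Real.sqrt_sq ha0.le]
  rw [etaPrimitive_inv ha, etaPrimitive_neg_two ha0, semicirclePrimitive_neg_two,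
    semicirclePrimitive, hroot]
  generalize |a - a⁻¹| = d
  generalize Real.arcsin (a⁻¹ / 2) = φ
  generalize Real.sqrt (4 * a ^ 2 - 1) = s
  field_simp
  ring

theorem nuSC_eq : nuSC = volume.withDensity fun x => ENNReal.ofReal (semicircleDensity x) := by
  unfold nuSC
  congr 1
  funext x
  congr 1
  split_ifs with h
  · rfl
  · rw [semicircleDensity, sqrt_four_sub_sq_eq_zero (fun h' => h (abs_lt.2 h')), zero_div]

theorem eta_eq (c : ℝ) :
    eta c = ENNReal.ofReal (if Real.exp c < 1 then 1 - Real.exp c ^ 2 else 0) •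
        Measure.dirac (Real.exp c + (Real.exp c)⁻¹) +
      volume.withDensity fun x => ENNReal.ofReal (etaDensity (Real.exp c) x) := by
  unfold eta
  rw [Real.exp_neg, show Real.exp (2 * c) = Real.exp c ^ 2 by rw [← Real.exp_nat_mul]; norm_num]
  simp only [Real.exp_lt_one_iff, ite_mul, one_mul, zero_mul]
  congr 2
  funext x
  congr 1
  rw [etaDensity]
  split_ifs with h
  · rw [mul_one]
  · rw [sqrt_four_sub_sq_eq_zero (fun h' => h (abs_lt.2 h'))]
    simp

theorem withDensity_ofReal_real_apply {k : ℝ → ℝ} (hk : Integrable k) (hpos : ∀ x, 0 ≤ k x)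
    {A : Set ℝ} (hA : MeasurableSet A) :
    (volume.withDensity fun x => ENNReal.ofReal (k x)).real A = ∫ x in A, k x := by
  rw [Measure.real, withDensity_apply _ hA,
    integral_eq_lintegral_of_nonneg_ae (Filter.Eventually.of_forall hpos)
      hk.aestronglyMeasurable.restrict]

theorem nuSC_real_apply {A : Set ℝ} (hA : MeasurableSet A) :
    nuSC.real A = ∫ x in A, semicircleDensity x := by
  rw [nuSC_eq, withDensity_ofReal_real_apply semicircle_integrals.1 semicircleDensity_nonneg hA]

theorem eta_real_apply (c : ℝ) {A : Set ℝ} (hA : MeasurableSet A) :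
    (eta c).real A = (if Real.exp c < 1 then 1 - Real.exp c ^ 2 else 0) *
        A.indicator 1 (Real.exp c + (Real.exp c)⁻¹) + ∫ x in A, etaDensity (Real.exp c) x := by
  have hp := (etaDensity_integrals (Real.exp_pos c)).1
  have := isFiniteMeasure_withDensity_ofReal hp.2
  have hw : 0 ≤ (if Real.exp c < 1 then 1 - Real.exp c ^ 2 else 0) := by
    split_ifs with h
    · nlinarith [Real.exp_pos c]
    · exact le_rfl
  rw [eta_eq, measureReal_add_apply 
      (ENNReal.mul_ne_top ENNReal.ofReal_ne_top (measure_ne_top _ _)),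
    withDensity_ofReal_real_apply hp (etaDensity_nonneg (Real.exp_pos c)) hA,
    measureReal_ennreal_smul_apply, ENNReal.toReal_ofReal hw, Measure.real,
    Measure.dirac_apply' _ hA]
  congr 2
  by_cases h : Real.exp c + (Real.exp c)⁻¹ ∈ A <;> simp [h]

instance isProbabilityMeasure_nuSC : IsProbabilityMeasure nuSC := by
  have h : nuSC.real Set.univ = 1 := by
    rw [nuSC_real_apply .univ, setIntegral_univ, integral_semicircleDensity]
  exact ⟨by rwa [Measure.real, ENNReal.toReal_eq_one_iff] at h⟩

instance isProbabilityMeasure_eta (c : ℝ) : IsProbabilityMeasure (eta c) := by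
  have h : (eta c).real Set.univ = 1 := by
    rw [eta_real_apply c .univ, setIntegral_univ, integral_etaDensity (Real.exp_pos c)]
    split_ifs <;> simp
  exact ⟨by rwa [Measure.real, ENNReal.toReal_eq_one_iff] at h⟩

theorem etaDensity_le_semicircleDensity {a x : ℝ} (ha : 0 < a) (hx : x ≤ a⁻¹) :
    etaDensity a x ≤ semicircleDensity x := by
  have h : 0 < a + a⁻¹ - x := by linarith
  rw [etaDensity, semicircleDensity, div_le_div_iff₀ (by positivity) (by positivity)]
  have : 0 ≤ Real.sqrt (4 - x ^ 2) * Real.pi * (a⁻¹ - x) :=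
    mul_nonneg (by positivity) (by linarith)
  nlinarith

theorem semicircleDensity_le_etaDensity {a x : ℝ} (ha : 0 < a) (hx : a⁻¹ ≤ x ∨ 2 ≤ x) :
    semicircleDensity x ≤ etaDensity a x := by
  by_cases hx2 : x ∈ Set.Ioo (-2 : ℝ) 2
  · have h : 0 < a + a⁻¹ - x := by linarith [two_le_add_inv ha, hx2.2]
    have hx' : a⁻¹ ≤ x := hx.resolve_right (not_le.2 hx2.2)
    rw [etaDensity, semicircleDensity, div_le_div_iff₀ (by positivity) (by positivity)]
    have : 0 ≤ Real.sqrt (4 - x ^ 2) * Real.pi * (x - a⁻¹) :=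
      mul_nonneg (by positivity) (by linarith)
    nlinarith
  · simp [etaDensity, semicircleDensity, sqrt_four_sub_sq_eq_zero hx2]

theorem setIntegral_le_setIntegral_of_sign {k : ℝ → ℝ} (hk : Integrable k) {S A : Set ℝ}
    (hS : MeasurableSet S) (hA : MeasurableSet A) (hpos : ∀ x ∈ S, 0 ≤ k x)
    (hneg : ∀ x ∉ S, k x ≤ 0) : ∫ x in A, k x ≤ ∫ x in S, k x := by
  rw [← integral_indicator hA, ← integral_indicator hS]
  refine integral_mono (hk.indicator hA) (hk.indicator hS) fun x => ?_
  by_cases h1 : x ∈ A <;> by_cases h2 : x ∈ S <;> simp [h1, h2, hpos, hneg]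

theorem dTV_eta_nuSC_eq_primitive (c : ℝ) :
    dTV (eta c) nuSC =
      (semicirclePrimitive (min (Real.exp c)⁻¹ 2) - semicirclePrimitive (-2)) -
        (etaPrimitive (Real.exp c) (min (Real.exp c)⁻¹ 2) - etaPrimitive (Real.exp c) (-2)) := by
  have ha := Real.exp_pos c
  have hprob : ∀ A, MeasurableSet A → _ := fun A hA => eta_real_apply c (A := A) hA
  generalize Real.exp c = a at *
  have hb : 0 < a⁻¹ := by positivity
  obtain ⟨hp, hpI, -⟩ := etaDensity_integrals ha
  obtain ⟨hq, hqI, -⟩ := semicircle_integrals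
  have hr : min a⁻¹ 2 ∈ Set.Icc (-2 : ℝ) 2 :=
    ⟨le_min (by linarith) (by norm_num), min_le_right _ _⟩
  have hatom : a + a⁻¹ ∉ Set.Iic (min a⁻¹ 2) := fun h => by
    have := (Set.mem_Iic.1 h).trans (min_le_left _ _)
    linarith
  have hS : nuSC.real (Set.Iic (min a⁻¹ 2)) - (eta c).real (Set.Iic (min a⁻¹ 2)) =
      ∫ x in Set.Iic (min a⁻¹ 2), (semicircleDensity x - etaDensity a x) := by
    rw [integral_sub hq.integrableOn hp.integrableOn, nuSC_real_apply measurableSet_Iic,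
      hprob _ measurableSet_Iic, Set.indicator_of_notMem hatom, mul_zero, zero_add]
  have hw : 0 ≤ (if a < 1 then 1 - a ^ 2 else 0) := by
    split_ifs with h
    · nlinarith
    · exact le_rfl
  rw [dTV_eq_of_maximizer (eta c) nuSC (S := Set.Iic (min a⁻¹ 2)) measurableSet_Iic, hS,
    integral_sub hq.integrableOn hp.integrableOn, hqI _ hr, hpI _ hr]
  intro A hA
  rw [hS, nuSC_real_apply hA, hprob A hA]
  have hsign := setIntegral_le_setIntegral_of_sign (hq.sub hp)
    (measurableSet_Iic (a := min a⁻¹ 2)) hA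
    (fun x hx => sub_nonneg.2 <|
      etaDensity_le_semicircleDensity ha ((Set.mem_Iic.1 hx).trans (min_le_left _ _)))
    (fun x hx => sub_nonpos.2 <| semicircleDensity_le_etaDensity ha <| by
      rw [Set.mem_Iic, not_le, min_lt_iff] at hx
      exact hx.imp le_of_lt le_of_lt)
  simp only [Pi.sub_apply] at hsign
  rw [integral_sub hq.integrableOn hp.integrableOn] at hsign
  have hi : 0 ≤ A.indicator (1 : ℝ → ℝ) (a + a⁻¹) :=
    Set.indicator_nonneg (fun _ _ => zero_le_one) _
  linarith [mul_nonneg hw hi]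

/-- The limit profile of the Brownian motion: `d_TV(η_c, ν_SC) = f₁(c)`. -/
theorem dTV_eta_nuSC (c : ℝ) :
    dTV (eta c) nuSC =
      if -Real.log 2 ≤ c then
        2 * (1 - Real.exp (2 * c)) / Real.pi * Real.arcsin (Real.exp (-c) / 2) +
          (Real.exp (-2 * c) + 2) / (4 * Real.pi) * Real.sqrt (4 * Real.exp (2 * c) - 1)
      else 1 - Real.exp (2 * c) := by
  have ha := Real.exp_pos c
  have h2 : Real.exp (2 * c) = Real.exp c ^ 2 := by rw [← Real.exp_nat_mul]; norm_num
  have hm2 : Real.exp (-2 * c) = (Real.exp c ^ 2)⁻¹ := by rw [← h2, ← Real.exp_neg]; ring_nf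
  have hiff : -Real.log 2 ≤ c ↔ 2⁻¹ ≤ Real.exp c := by
    rw [← Real.log_inv, Real.log_le_iff_le_exp (by norm_num)]
  rw [dTV_eta_nuSC_eq_primitive, h2, hm2, Real.exp_neg]
  simp only [hiff]
  generalize Real.exp c = a at *
  split_ifs with h
  · rw [min_eq_left (inv_le_of_inv_le₀ (by norm_num) h), primitive_difference_at_inv h]
  · rw [not_le] at h
    rw [min_eq_right ((le_inv_comm₀ (by norm_num) ha).2 h.le), ← semicircle_integrals.2.2,
      ← (etaDensity_integrals ha).2.2, integral_semicircleDensity, integral_etaDensity ha,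
      if_pos (by linarith)]
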